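/- Let (P_k)_{k∈K} be a discrete POVM of d×d complex matrices, let m ≥ 1, let a : K → ℂ^m be a scale with A_j := Σ_{k∈K} (a_k)_j·P_k, let ρ be a density matrix, and let X_1,…,X_m be d×d complex matrices. Let Ā, X̄ ∈ ℂ^m have components Ā_j := Tr(ρ·A_j) and X̄_j := Tr(ρ·X_j), and set σ_A² := Tr(ρ·Σ_j (A_j − Ā_j·1)ᴴ(A_j − Ā_j·1)) and σ_X² := Tr(ρ·Σ_j (X_j − X̄_j·1)ᴴ(X_j − X̄_j·1)). Then the squared measurement uncertainty satisfies Σ_{k∈K} Tr(ρ·P_k)·‖a_k − X̄‖² + max(σ_X² − σ_A², 0) ≥ σ_X² + ‖Ā − X̄‖². -/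

import Mathlib

open Matrix BigOperators
open scoped ComplexOrder

open scoped MatrixOrder in
lemma aux_trace_nonneg {d : ℕ} {ρ M : Matrix (Fin d) (Fin d) ℂ} (hρ : ρ.PosSemidef)
    (hM : M.PosSemidef) : 0 ≤ ((ρ * M).trace).re := by
  obtain ⟨C, rfl⟩ := CStarAlgebra.nonneg_iff_eq_star_mul_self.mp hρ.nonneg
  rw [Matrix.star_eq_conjTranspose]
  have h1 : (Cᴴ * C * M).trace = (C * M * Cᴴ).trace := by
    rw [Matrix.mul_assoc, Matrix.trace_mul_comm]
  rw [h1]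
  have h2 := (hM.mul_mul_conjTranspose_same C).trace_nonneg
  exact (Complex.le_def.mp h2).1

lemma aux_kadison {d : ℕ} {K : Type*} [Fintype K]
    (P : K → Matrix (Fin d) (Fin d) ℂ)
    (hP : ∀ k, (P k).PosSemidef) (hP1 : ∑ k, P k = 1)
    (ρ : Matrix (Fin d) (Fin d) ℂ) (hρ : ρ.PosSemidef) (b : K → ℂ)
    (B : Matrix (Fin d) (Fin d) ℂ) (hB : B = ∑ k, b k • P k) :
    ((ρ * (Bᴴ * B)).trace).re ≤ ∑ k, ((ρ * P k).trace).re * ‖b k‖ ^ 2 := by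
  have hBH : Bᴴ = ∑ k, star (b k) • P k := by
    rw [hB, Matrix.conjTranspose_sum]
    refine Finset.sum_congr rfl fun k _ => ?_
    rw [Matrix.conjTranspose_smul, (hP k).1.eq]
  have hpos : (∑ k, (b k • 1 - B)ᴴ * P k * (b k • 1 - B)).PosSemidef :=
    Matrix.posSemidef_sum _ fun k _ => (hP k).conjTranspose_mul_mul_same _
  have hexp : (∑ k, (b k • 1 - B)ᴴ * P k * (b k • 1 - B))
      = ∑ k, ((‖b k‖ ^ 2 : ℝ) : ℂ) • P k - Bᴴ * B := by
    have h1 : ∀ k, (b k • 1 - B)ᴴ * P k * (b k • 1 - B)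
        = ((‖b k‖ ^ 2 : ℝ) : ℂ) • P k - (star (b k) • P k) * B - Bᴴ * (b k • P k)
          + Bᴴ * P k * B := by
      intro k
      have hn : ((‖b k‖ ^ 2 : ℝ) : ℂ) = b k * star (b k) := by
        rw [Complex.star_def, Complex.mul_conj, Complex.normSq_eq_norm_sq]
      rw [hn]
      simp only [Matrix.conjTranspose_sub, Matrix.conjTranspose_smul, Matrix.conjTranspose_one,
        sub_mul, mul_sub, Matrix.smul_mul, Matrix.mul_smul, one_mul, mul_one, smul_smul]
      abel
    simp only [h1, Finset.sum_add_distrib, Finset.sum_sub_distrib, ← Finset.sum_mul,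
      ← Finset.mul_sum, hP1, ← hBH, ← hB]
    simp
  have h := aux_trace_nonneg hρ hpos
  rw [hexp, mul_sub, Matrix.trace_sub, Complex.sub_re, Finset.mul_sum, Matrix.trace_sum,
    Complex.re_sum] at h
  have h2 : ∀ k, ((ρ * (((‖b k‖ ^ 2 : ℝ) : ℂ) • P k)).trace).re
      = ((ρ * P k).trace).re * ‖b k‖ ^ 2 := by
    intro k
    rw [Matrix.mul_smul, Matrix.trace_smul, smul_eq_mul, Complex.re_ofReal_mul, mul_comm]
  simp only [h2] at h
  linarith

lemma aux_shift {d : ℕ} (ρ : Matrix (Fin d) (Fin d) ℂ) (hρ : ρ.PosSemidef) (hρ1 : ρ.trace = 1)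
    (D : Matrix (Fin d) (Fin d) ℂ) (hD : (ρ * D).trace = 0) (c : ℂ) :
    ((ρ * ((D + c • 1)ᴴ * (D + c • 1))).trace).re = ((ρ * (Dᴴ * D)).trace).re + ‖c‖ ^ 2 := by
  have hD' : (ρ * Dᴴ).trace = 0 := by
    have : (ρ * Dᴴ).trace = star ((ρ * D).trace) := by
      rw [← Matrix.trace_conjTranspose, Matrix.conjTranspose_mul, hρ.1.eq, Matrix.trace_mul_comm]
    rw [this, hD, star_zero]
  have hn : c * star c = ((‖c‖ ^ 2 : ℝ) : ℂ) := by
    rw [Complex.star_def, Complex.mul_conj, Complex.normSq_eq_norm_sq]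
  have h : (ρ * ((D + c • 1)ᴴ * (D + c • 1))).trace
      = (ρ * (Dᴴ * D)).trace + ((‖c‖ ^ 2 : ℝ) : ℂ) := by
    rw [← hn]
    simp only [Matrix.conjTranspose_add, Matrix.conjTranspose_smul, Matrix.conjTranspose_one,
      add_mul, mul_add, Matrix.smul_mul, Matrix.mul_smul, one_mul, mul_one, smul_smul,
      Matrix.trace_add, Matrix.trace_smul, hD, hD', hρ1, smul_eq_mul, mul_zero, add_zero, zero_add]
  rw [h, Complex.add_re, Complex.ofReal_re]

/-- The squared measurement uncertainty of an imperfect measurement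
of X by a detector measuring A satisfies
Σ_k Tr(ρP_k)‖a_k − X̄‖² + max(σ_X² − σ_A², 0) ≥ σ_X² + ‖Ā − X̄‖². -/
theorem measurement_uncertainty_lower_bound {d : ℕ} {K : Type*} [Fintype K]
    (P : K → Matrix (Fin d) (Fin d) ℂ)
    (hP : ∀ k, (P k).PosSemidef) (hP1 : ∑ k, P k = 1)
    {m : ℕ} (hm : 1 ≤ m) (a : K → Fin m → ℂ)
    (A : Fin m → Matrix (Fin d) (Fin d) ℂ)
    (hA : ∀ j, A j = ∑ k, a k j • P k)
    (ρ : Matrix (Fin d) (Fin d) ℂ) (hρ : ρ.PosSemidef) (hρ1 : ρ.trace = 1)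
    (X : Fin m → Matrix (Fin d) (Fin d) ℂ)
    (Abar Xbar : Fin m → ℂ)
    (hAbar : ∀ j, Abar j = (ρ * A j).trace)
    (hXbar : ∀ j, Xbar j = (ρ * X j).trace)
    (σA2 σX2 : ℝ)
    (hσA : σA2 = ((ρ * ∑ j, ((A j - Abar j • 1)ᴴ * (A j - Abar j • 1))).trace).re)
    (hσX : σX2 = ((ρ * ∑ j, ((X j - Xbar j • 1)ᴴ * (X j - Xbar j • 1))).trace).re) :
    ∑ k, ((ρ * P k).trace).re * (∑ j, ‖a k j - Xbar j‖ ^ 2) + max (σX2 - σA2) 0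
      ≥ σX2 + ∑ j, ‖Abar j - Xbar j‖ ^ 2 := by
  have key : ∀ j, ((ρ * ((A j - Abar j • 1)ᴴ * (A j - Abar j • 1))).trace).re
      + ‖Abar j - Xbar j‖ ^ 2 ≤ ∑ k, ((ρ * P k).trace).re * ‖a k j - Xbar j‖ ^ 2 := by
    intro j
    have hD : (ρ * (A j - Abar j • 1)).trace = 0 := by
      rw [mul_sub, Matrix.trace_sub, Matrix.mul_smul, mul_one, Matrix.trace_smul, hρ1, hAbar j]
      simp
    rw [← aux_shift ρ hρ hρ1 _ hD (Abar j - Xbar j)]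
    refine aux_kadison P hP hP1 ρ hρ (fun k => a k j - Xbar j) _ ?_
    simp only [sub_smul, Finset.sum_sub_distrib, ← Finset.smul_sum, hP1, ← hA j]
    abel
  have hsum := Finset.sum_le_sum fun j (_ : j ∈ Finset.univ) => key j
  rw [Finset.sum_add_distrib, Finset.sum_comm] at hsum
  simp only [← Finset.mul_sum] at hsum
  rw [Finset.mul_sum, Matrix.trace_sum, Complex.re_sum] at hσA
  rw [← hσA] at hsum
  have := le_max_left (σX2 - σA2) 0
  linarith
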